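/- arXiv:2204.11359 — 3 statements merged into one kernel-verified Lean document; each statement's English description precedes it below -/
import Mathlib

section
/- Let $\alpha\in(0,1)$, $s<t$, and let $u,\rho:[s,t]\to\mathbb{R}$ be continuously differentiable with $\rho\ge0$, $u'(\tau)+2\rho(\tau)=\varphi(\tau)$ on $[s,t]$ for a continuous function $\varphi$, and $\rho(s)<\tan(\alpha\pi/2)$, $\rho(t)<\tan(\alpha\pi/2)$. Let $J(\alpha):=\{\tau\in(s,t):\rho(\tau)>\tan(\alpha\pi/2)\}$. Then $\displaystyle u(t)+2\int_s^t p(\alpha,\rho(\tau))\,\rho(\tau)\,d\tau+\frac{2}{(1-\alpha)\pi}\int_{J(\alpha)}\frac{u(\tau)\,\rho'(\tau)}{1+\rho(\tau)^2}\,d\tau=u(s)+\int_s^t\varphi(\tau)\,p(\alpha,\rho(\tau))\,d\tau$. -/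
open MeasureTheory Filter Set Real intervalIntegral
open scoped Topology

/-- The cut-off function `p(α,ρ)` of the paper: `p(α,ρ) = 1` if `ρ ≤ tan(απ/2)` and
`p(α,ρ) = (π/2 - arctan ρ)/((1-α)π/2)` if `ρ > tan(απ/2)`. -/
noncomputable def cutoff (α ρ : ℝ) : ℝ :=
  if ρ ≤ Real.tan (α * (Real.pi / 2)) then 1
  else (Real.pi / 2 - Real.arctan ρ) / ((1 - α) * (Real.pi / 2))

/-- The cut-off function in closed form, as an affine function of a positive part. -/
lemma cutoff_eq_one_sub_mul_max {α : ℝ} (hα : α ∈ Set.Ioo (0 : ℝ) 1) (x : ℝ) :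
    cutoff α x = 1 - 2 / ((1 - α) * π) * max 0 (arctan x - α * (π / 2)) := by
  have hπ := Real.pi_pos
  have hα' : (1 - α) ≠ 0 := by linarith [hα.2]
  have hat : arctan (tan (α * (π / 2))) = α * (π / 2) :=
    arctan_tan (by nlinarith [hα.1]) (by nlinarith [hα.2])
  unfold cutoff
  split_ifs with h
  · have := arctan_mono h
    rw [max_eq_left (by linarith)]
    ring
  · have := arctan_strictMono (not_le.mp h)
    rw [max_eq_right (by linarith)]
    field_simp
    ring

lemma hasDerivAt_max_zero {g : ℝ → ℝ} {g' x : ℝ} (hg : HasDerivAt g g' x)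
    (h : g x = 0 → g' = 0) :
    HasDerivAt (fun y ↦ max 0 (g y)) (if 0 < g x then g' else 0) x := by
  rcases lt_trichotomy (g x) 0 with hx | hx | hx
  · rw [if_neg hx.not_gt]
    refine (hasDerivAt_const x (0 : ℝ)).congr_of_eventuallyEq ?_
    filter_upwards [hg.continuousAt.eventually (gt_mem_nhds hx)] with y hy
    exact max_eq_left hy.le
  · rw [if_neg hx.not_gt]
    rw [h hx, hasDerivAt_iff_isLittleO] at hg
    rw [hasDerivAt_iff_isLittleO]
    refine (Asymptotics.isBigO_of_le _ fun y ↦ ?_).trans_isLittleO hg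
    simp only [hx, max_self, smul_zero, sub_zero, Real.norm_eq_abs]
    rw [abs_of_nonneg (le_max_left _ _)]
    exact max_le (abs_nonneg _) (le_abs_self _)
  · rw [if_pos hx]
    refine hg.congr_of_eventuallyEq ?_
    filter_upwards [hg.continuousAt.eventually (lt_mem_nhds hx)] with y hy
    exact max_eq_right hy.le

/-- The zeros of a function at which its derivative does not vanish are isolated, hence
countably many. -/
lemma countable_zeros_of_hasDerivAt_ne_zero {g g' : ℝ → ℝ} {U : Set ℝ}
    (hg : ∀ x ∈ U, HasDerivAt g (g' x) x) :
    {x | x ∈ U ∧ g x = 0 ∧ g' x ≠ 0}.Countable := by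
  refine (HereditarilyLindelofSpace.isLindelof _).countable_of_isDiscrete
    (isDiscrete_iff_nhdsNE.mpr ?_)
  rintro x ⟨hxU, -, hx'⟩
  rw [← disjoint_iff, disjoint_principal_right]
  filter_upwards [(hg x hxU).eventually_ne (c := 0) hx'] with y hy hyS
  exact hy hyS.2.1

/-- Integration by parts for the product of a `C¹` function with the positive part of another. -/
lemma integral_deriv_mul_max_zero_add {s t : ℝ} (hst : s ≤ t) {u u' g g' : ℝ → ℝ}
    (huc : ContinuousOn u (Icc s t)) (hgc : ContinuousOn g (Icc s t))
    (hu : ∀ x ∈ Ioo s t, HasDerivAt u (u' x) x) (hg : ∀ x ∈ Ioo s t, HasDerivAt g (g' x) x)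
    (hu'c : ContinuousOn u' (Icc s t)) (hg'c : ContinuousOn g' (Icc s t)) :
    (∫ x in s..t, u' x * max 0 (g x)) + ∫ x in {x | x ∈ Ioo s t ∧ 0 < g x}, u x * g' x
      = u t * max 0 (g t) - u s * max 0 (g s) := by
  set J : Set ℝ := {x | x ∈ Ioo s t ∧ 0 < g x}
  have hJo : IsOpen J :=
    (hgc.mono Ioo_subset_Icc_self).isOpen_inter_preimage isOpen_Ioo isOpen_Ioi
  have hJsub : J ⊆ Ioc s t := fun x hx ↦ Ioo_subset_Ioc_self hx.1
  have hmc : ContinuousOn (fun x ↦ max 0 (g x)) (Icc s t) := by fun_prop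
  have hi₁ : IntervalIntegrable (fun x ↦ u' x * max 0 (g x)) volume s t :=
    (hu'c.mul hmc).intervalIntegrable_of_Icc hst
  have hi₂ : IntervalIntegrable (J.indicator fun x ↦ u x * g' x) volume s t := by
    rw [intervalIntegrable_iff_integrableOn_Ioc_of_le hst]
    exact (((huc.mul hg'c).integrableOn_Icc).mono_set Ioc_subset_Icc_self).indicator
      hJo.measurableSet
  have hJint : ∫ x in J, u x * g' x = ∫ x in s..t, J.indicator (fun x ↦ u x * g' x) x := by
    rw [intervalIntegral.integral_of_le hst, setIntegral_indicator hJo.measurableSet,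
      inter_eq_self_of_subset_right hJsub]
  rw [hJint, ← intervalIntegral.integral_add hi₁ hi₂]
  refine integral_eq_of_hasDerivAt_off_countable_of_le (fun x ↦ u x * max 0 (g x)) _ hst
    (countable_zeros_of_hasDerivAt_ne_zero hg) (huc.mul hmc) ?_ (hi₁.add hi₂)
  rintro x ⟨hx, hxZ⟩
  have hm := hasDerivAt_max_zero (hg x hx) fun h0 ↦ by
    by_contra h1
    exact hxZ ⟨hx, h0, h1⟩
  refine ((hu x hx).mul hm).congr_deriv ?_
  by_cases h : 0 < g x
  · rw [if_pos h, indicator_of_mem (show x ∈ J from ⟨hx, h⟩)]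
  · rw [if_neg h, indicator_of_notMem (fun hxJ : x ∈ J ↦ h hxJ.2), mul_zero]

/-- Let `α ∈ (0,1)`, `s < t`, and `u, ρ : [s,t] → ℝ` continuously
differentiable with `ρ ≥ 0`, `u' + 2ρ = φ` on `[s,t]` for a continuous `φ`, and
`ρ(s), ρ(t) < tan(απ/2)`.  With `J(α) := {τ ∈ (s,t) : ρ(τ) > tan(απ/2)}`, one has
`u(t) + 2∫_s^t p(α,ρ(τ))ρ(τ) dτ + (2/((1-α)π)) ∫_{J(α)} u ρ'/(1+ρ²) dτ
  = u(s) + ∫_s^t φ(τ) p(α,ρ(τ)) dτ`. -/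
theorem stmt10 (α s t : ℝ) (hα : α ∈ Set.Ioo (0:ℝ) 1) (hst : s < t)
    (u ρ u' ρ' φ : ℝ → ℝ)
    (hρ_nonneg : ∀ τ ∈ Set.Icc s t, 0 ≤ ρ τ)
    (hu : ∀ τ ∈ Set.Icc s t, HasDerivWithinAt u (u' τ) (Set.Icc s t) τ)
    (hρ : ∀ τ ∈ Set.Icc s t, HasDerivWithinAt ρ (ρ' τ) (Set.Icc s t) τ)
    (hu'c : ContinuousOn u' (Set.Icc s t))
    (hρ'c : ContinuousOn ρ' (Set.Icc s t))
    (hφc : ContinuousOn φ (Set.Icc s t))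
    (heq : ∀ τ ∈ Set.Icc s t, u' τ + 2 * ρ τ = φ τ)
    (hρs : ρ s < Real.tan (α * (Real.pi / 2)))
    (hρt : ρ t < Real.tan (α * (Real.pi / 2))) :
    u t + 2 * (∫ τ in s..t, cutoff α (ρ τ) * ρ τ)
      + 2 / ((1 - α) * Real.pi) *
        ∫ τ in {τ | τ ∈ Set.Ioo s t ∧ Real.tan (α * (Real.pi / 2)) < ρ τ},
          u τ * ρ' τ / (1 + ρ τ ^ 2)
      = u s + ∫ τ in s..t, φ τ * cutoff α (ρ τ) := by
  have hIcc : ∀ x ∈ Ioo s t, Icc s t ∈ 𝓝 x := fun x hx ↦ Icc_mem_nhds hx.1 hx.2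
  have huc : ContinuousOn u (Icc s t) := fun x hx ↦ (hu x hx).continuousWithinAt
  have hρc : ContinuousOn ρ (Icc s t) := fun x hx ↦ (hρ x hx).continuousWithinAt
  have hat : arctan (tan (α * (π / 2))) = α * (π / 2) :=
    arctan_tan (by nlinarith [hα.1, Real.pi_pos]) (by nlinarith [hα.2, Real.pi_pos])
  have hpos : ∀ x, 0 < arctan x - α * (π / 2) ↔ tan (α * (π / 2)) < x := fun x ↦ by
    rw [sub_pos, ← arctan_strictMono.lt_iff_lt (a := tan _), hat]
  have hmax : ∀ x, x < tan (α * (π / 2)) → max 0 (arctan x - α * (π / 2)) = 0 := fun x hx ↦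
    max_eq_left (not_lt.mp fun h ↦ ((hpos x).mp h).not_gt hx)
  have hu_at : ∀ x ∈ Ioo s t, HasDerivAt u (u' x) x := fun x hx ↦
    (hu x (Ioo_subset_Icc_self hx)).hasDerivAt (hIcc x hx)
  have hgc : ContinuousOn (fun x ↦ arctan (ρ x) - α * (π / 2)) (Icc s t) :=
    (continuous_arctan.comp_continuousOn hρc).sub continuousOn_const
  have hparts := integral_deriv_mul_max_zero_add hst.le huc hgc hu_at
    (g' := fun x ↦ 1 / (1 + ρ x ^ 2) * ρ' x)
    (fun x hx ↦ (((hρ x (Ioo_subset_Icc_self hx)).hasDerivAt (hIcc x hx)).arctan).sub_const _)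
    hu'c ((continuousOn_const.div (continuousOn_const.add (hρc.pow 2))
      fun x _ ↦ (by positivity : 1 + ρ x ^ 2 ≠ 0)).mul hρ'c)
  simp only [hmax _ hρs, hmax _ hρt, hpos, mul_zero, sub_zero] at hparts
  have hJ : ∀ x, u x * ρ' x / (1 + ρ x ^ 2) = u x * (1 / (1 + ρ x ^ 2) * ρ' x) := fun x ↦ by
    ring
  have hftc : ∫ x in s..t, u' x = u t - u s :=
    integral_eq_sub_of_hasDerivAt_of_le hst.le huc hu_at (hu'c.intervalIntegrable_of_Icc hst.le)
  have hpc : ContinuousOn (fun x ↦ cutoff α (ρ x)) (Icc s t) := by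
    simp only [cutoff_eq_one_sub_mul_max hα]
    fun_prop
  have hsplit : (∫ x in s..t, φ x * cutoff α (ρ x)) - 2 * (∫ x in s..t, cutoff α (ρ x) * ρ x)
      = (∫ x in s..t, u' x) - 2 / ((1 - α) * π) *
        ∫ x in s..t, u' x * max 0 (arctan (ρ x) - α * (π / 2)) := by
    rw [← intervalIntegral.integral_const_mul, ← intervalIntegral.integral_const_mul,
      ← intervalIntegral.integral_sub
        (ContinuousOn.intervalIntegrable_of_Icc hst.le (by fun_prop))
        (ContinuousOn.intervalIntegrable_of_Icc hst.le (by fun_prop)),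
      ← intervalIntegral.integral_sub
        (ContinuousOn.intervalIntegrable_of_Icc hst.le (by fun_prop))
        (ContinuousOn.intervalIntegrable_of_Icc hst.le (by fun_prop))]
    refine intervalIntegral.integral_congr fun x hx ↦ ?_
    rw [uIcc_of_le hst.le] at hx
    simp only [← heq x hx, cutoff_eq_one_sub_mul_max hα]
    ring
  simp only [hJ]
  linear_combination -hsplit - hftc + 2 / ((1 - α) * π) * hparts
end

section
/- Let $T>0$, $c\ge0$, let $\rho:[0,T]\to[0,\infty)$ be continuously differentiable with $\rho\in L^1(0,T)$, and let $g\in L^1(0,T)$ be non-negative with $\rho'(t)\le c\,\rho(t)^3+g(t)$ for almost every $t\in(0,T)$. Then $\displaystyle\int_0^T\frac{|\rho'(t)|}{(1+\rho(t))^2}\,dt\le 1+2c\int_0^T\rho(t)\,dt+2\int_0^T g(t)\,dt$. -/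
open MeasureTheory Filter Set
open scoped Topology

/-- Pointwise form of the estimate: `|a| = 2 a⁺ - a`, and `(c r³ + b) / (1 + r)² ≤ c r + b`. -/
lemma abs_div_one_add_sq_le {a b c r : ℝ} (hc : 0 ≤ c) (hr : 0 ≤ r) (hb : 0 ≤ b)
    (h : a ≤ c * r ^ 3 + b) :
    |a| / (1 + r) ^ 2 ≤ 2 * c * r + 2 * b + -a / (1 + r) ^ 2 := by
  have hD : 0 < (1 + r) ^ 2 := by positivity
  rw [← sub_le_iff_le_add, ← sub_div, div_le_iff₀ hD]
  have hcr : 0 ≤ c * r := mul_nonneg hc hr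
  have hbr : 0 ≤ b * r := mul_nonneg hb hr
  have hcr2 : 0 ≤ c * r * r := mul_nonneg hcr hr
  have hbr2 : 0 ≤ b * r * r := mul_nonneg hbr hr
  rcases abs_cases a with ⟨ha, -⟩ | ⟨ha, -⟩ <;> rw [ha]
  · nlinarith
  · rw [sub_self]
    positivity

/-- The fundamental theorem of calculus for `1 / (1 + ρ)`. -/
lemma integral_neg_deriv_div_one_add_sq {T : ℝ} (hT : 0 ≤ T) {ρ ρ' : ℝ → ℝ}
    (hρ_nonneg : ∀ t ∈ Set.Icc 0 T, 0 ≤ ρ t)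
    (hρ_deriv : ∀ t ∈ Set.Icc 0 T, HasDerivWithinAt ρ (ρ' t) (Set.Icc 0 T) t)
    (hint : IntegrableOn (fun t => -ρ' t / (1 + ρ t) ^ 2) (Set.Icc 0 T)) :
    ∫ t in Set.Ioo 0 T, -ρ' t / (1 + ρ t) ^ 2 = (1 + ρ T)⁻¹ - (1 + ρ 0)⁻¹ := by
  have hderiv : ∀ t ∈ Set.Icc 0 T, HasDerivWithinAt (fun s => (1 + ρ s)⁻¹)
      (-ρ' t / (1 + ρ t) ^ 2) (Set.Icc 0 T) t := fun t ht =>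
    ((hρ_deriv t ht).const_add 1).fun_inv (by linarith [hρ_nonneg t ht])
  rw [← integral_Ioc_eq_integral_Ioo, ← intervalIntegral.integral_of_le hT]
  refine intervalIntegral.integral_eq_sub_of_hasDerivAt_of_le hT
    (fun t ht => (hderiv t ht).continuousWithinAt)
    (fun t ht => (hderiv t (Ioo_subset_Icc_self ht)).hasDerivAt (Icc_mem_nhds ht.1 ht.2)) ?_
  rwa [intervalIntegrable_iff_integrableOn_Icc_of_le hT]

/-- Let `T > 0`, `c ≥ 0`, `ρ : [0,T] → [0,∞)` continuously
differentiable (with derivative `ρ'`) and integrable on `(0,T)`, and let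
`g ∈ L¹(0,T)` be non-negative with `ρ'(t) ≤ c ρ(t)³ + g(t)` for a.e. `t ∈ (0,T)`.
Then `∫₀ᵀ |ρ'(t)|/(1+ρ(t))² dt ≤ 1 + 2c ∫₀ᵀ ρ + 2 ∫₀ᵀ g`. -/
theorem stmt11 (T c : ℝ) (hT : 0 < T) (hc : 0 ≤ c) (ρ ρ' g : ℝ → ℝ)
    (hρ_nonneg : ∀ t ∈ Set.Icc 0 T, 0 ≤ ρ t)
    (hρ_deriv : ∀ t ∈ Set.Icc 0 T, HasDerivWithinAt ρ (ρ' t) (Set.Icc 0 T) t)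
    (hρ'_cont : ContinuousOn ρ' (Set.Icc 0 T))
    (hρ_int : IntegrableOn ρ (Set.Ioo 0 T))
    (hg_int : IntegrableOn g (Set.Ioo 0 T))
    (hg_nonneg : ∀ᵐ t ∂(volume.restrict (Set.Ioo 0 T)), 0 ≤ g t)
    (hbound : ∀ᵐ t ∂(volume.restrict (Set.Ioo 0 T)), ρ' t ≤ c * ρ t ^ 3 + g t) :
    (∫ t in Set.Ioo 0 T, |ρ' t| / (1 + ρ t) ^ 2) ≤
      1 + 2 * c * (∫ t in Set.Ioo 0 T, ρ t) + 2 * ∫ t in Set.Ioo 0 T, g t := by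
  have hρ_cont : ContinuousOn ρ (Set.Icc 0 T) := fun t ht => (hρ_deriv t ht).continuousWithinAt
  have hsq_ne : ∀ t ∈ Set.Icc 0 T, (1 + ρ t) ^ 2 ≠ 0 := fun t ht => by
    have := hρ_nonneg t ht
    positivity
  have hsq_cont : ContinuousOn (fun t => (1 + ρ t) ^ 2) (Set.Icc 0 T) :=
    (continuousOn_const.add hρ_cont).pow 2
  have habs_int : IntegrableOn (fun t => |ρ' t| / (1 + ρ t) ^ 2) (Set.Ioo 0 T) :=
    (hρ'_cont.abs.div hsq_cont hsq_ne).integrableOn_Icc.mono_set Ioo_subset_Icc_self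
  have hneg_int : IntegrableOn (fun t => -ρ' t / (1 + ρ t) ^ 2) (Set.Icc 0 T) :=
    (hρ'_cont.neg.div hsq_cont hsq_ne).integrableOn_Icc
  have hneg_int' := hneg_int.mono_set (Ioo_subset_Icc_self (a := (0 : ℝ)) (b := T))
  have hρ_int' : IntegrableOn (fun t => 2 * c * ρ t) (Set.Ioo 0 T) := hρ_int.const_mul _
  have hg_int' : IntegrableOn (fun t => 2 * g t) (Set.Ioo 0 T) := hg_int.const_mul _
  have hsum_int : IntegrableOn (fun t => 2 * c * ρ t + 2 * g t) (Set.Ioo 0 T) :=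
    hρ_int'.add hg_int'
  have hFTC := integral_neg_deriv_div_one_add_sq hT.le hρ_nonneg hρ_deriv hneg_int
  have hle_one : (1 + ρ T)⁻¹ - (1 + ρ 0)⁻¹ ≤ 1 := by
    have h0 : 0 ≤ (1 + ρ 0)⁻¹ :=
      inv_nonneg.2 (by linarith [hρ_nonneg 0 (left_mem_Icc.2 hT.le)])
    have hT1 : (1 + ρ T)⁻¹ ≤ 1 :=
      inv_le_one_of_one_le₀ (by linarith [hρ_nonneg T (right_mem_Icc.2 hT.le)])
    linarith
  calc (∫ t in Set.Ioo 0 T, |ρ' t| / (1 + ρ t) ^ 2)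
      ≤ ∫ t in Set.Ioo 0 T, (2 * c * ρ t + 2 * g t + -ρ' t / (1 + ρ t) ^ 2) := by
        refine integral_mono_ae habs_int (hsum_int.add hneg_int') ?_
        filter_upwards [hg_nonneg, hbound, ae_restrict_mem measurableSet_Ioo] with t hgt hbt ht
        exact abs_div_one_add_sq_le hc (hρ_nonneg t (Ioo_subset_Icc_self ht)) hgt hbt
    _ = 2 * c * (∫ t in Set.Ioo 0 T, ρ t) + 2 * (∫ t in Set.Ioo 0 T, g t)
          + ((1 + ρ T)⁻¹ - (1 + ρ 0)⁻¹) := by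
        rw [integral_add hsum_int hneg_int', integral_add hρ_int' hg_int',
          integral_const_mul, integral_const_mul, hFTC]
    _ ≤ 1 + 2 * c * (∫ t in Set.Ioo 0 T, ρ t) + 2 * ∫ t in Set.Ioo 0 T, g t := by
        linarith
end

section
/- Let $(s,t)$ be a bounded interval, let $\rho_m,\rho:(s,t)\to[0,\infty)$ be measurable with $\rho_m(\tau)\to\rho(\tau)$ for almost every $\tau\in(s,t)$ and $\rho\in L^1(s,t)$. For each $\alpha\in(0,1)$ and each $m$, let $A_m(\alpha)\subseteq\{\tau\in(s,t):\rho_m(\tau)>\tan(\alpha\pi/2)\}$ be measurable. Then $\displaystyle\lim_{\alpha\to1^-}\limsup_{m\to\infty}\frac{1}{1-\alpha}\int_{A_m(\alpha)}\frac{\rho_m(\tau)^2}{1+\rho_m(\tau)^2}\,d\tau=0$. -/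
open MeasureTheory Filter Set Real
open scoped Topology

/-- A continuous cutoff that vanishes below `L / 2` and equals `1` above `L`. -/
noncomputable def rampCutoff (L x : ℝ) : ℝ := min 1 (2 / L * max (x - L / 2) 0)

theorem continuous_rampCutoff (L : ℝ) : Continuous (rampCutoff L) := by
  unfold rampCutoff
  fun_prop

theorem rampCutoff_nonneg {L : ℝ} (hL : 0 < L) (x : ℝ) : 0 ≤ rampCutoff L x :=
  le_min zero_le_one (by positivity)

theorem rampCutoff_le_one (L x : ℝ) : rampCutoff L x ≤ 1 := min_le_left _ _

theorem rampCutoff_eq_one {L x : ℝ} (hL : 0 < L) (hx : L ≤ x) : rampCutoff L x = 1 := by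
  refine min_eq_left ?_
  calc (1 : ℝ) = 2 / L * (L / 2) := by field_simp
    _ ≤ 2 / L * max (x - L / 2) 0 := by
        gcongr
        exact le_max_of_le_left (by linarith)

theorem norm_rampCutoff_le_one {L : ℝ} (hL : 0 < L) (x : ℝ) : ‖rampCutoff L x‖ ≤ 1 := by
  rw [Real.norm_of_nonneg (rampCutoff_nonneg hL x)]
  exact rampCutoff_le_one L x

theorem integrable_rampCutoff_comp {X : Type*} [MeasurableSpace X] {μ : Measure X}
    [IsFiniteMeasure μ] {L : ℝ} (hL : 0 < L) {f : X → ℝ} (hf : Measurable f) :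
    Integrable (fun x => rampCutoff L (f x)) μ :=
  .of_bound ((continuous_rampCutoff L).measurable.comp hf).aestronglyMeasurable 1
    (ae_of_all _ fun x => norm_rampCutoff_le_one hL (f x))

theorem sq_div_one_add_sq_nonneg (x : ℝ) : 0 ≤ x ^ 2 / (1 + x ^ 2) := by positivity

theorem sq_div_one_add_sq_le_one (x : ℝ) : x ^ 2 / (1 + x ^ 2) ≤ 1 :=
  (div_le_one (by positivity)).2 (by linarith)

/-- On `[1/2, 1)`, `tan (α π / 2)` blows up at least like `1 / (π (1 - α))`. -/
theorem inv_pi_mul_one_sub_le_tan {α : ℝ} (h : 1 / 2 ≤ α) (h1 : α < 1) :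
    (π * (1 - α))⁻¹ ≤ Real.tan (α * (π / 2)) := by
  have hpi := Real.pi_pos
  have hsin : α ≤ Real.sin (α * (π / 2)) := by
    have := Real.mul_le_sin (x := α * (π / 2)) (by positivity) (by nlinarith)
    rwa [show 2 / π * (α * (π / 2)) = α by field_simp] at this
  have hcos : Real.cos (α * (π / 2)) ≤ (1 - α) * (π / 2) := by
    rw [← Real.sin_pi_div_two_sub]
    refine (Real.sin_le (by nlinarith)).trans (by linarith)
  have hcos0 : 0 < Real.cos (α * (π / 2)) :=
    Real.cos_pos_of_mem_Ioo ⟨by nlinarith, by nlinarith⟩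
  have hα : 0 < 1 - α := by linarith
  rw [Real.tan_eq_sin_div_cos, inv_eq_one_div, div_le_div_iff₀ (by positivity) hcos0]
  nlinarith [mul_pos hpi hα]

/-- The truncated excess `∫ (f - c)⁺` of an integrable function vanishes as `c → ∞`. -/
theorem tendsto_integral_max_sub_zero {X ι : Type*} [MeasurableSpace X] {μ : Measure X}
    {l : Filter ι} [l.IsCountablyGenerated] {c : ι → ℝ} (hc : Tendsto c l atTop)
    {f : X → ℝ} (hf : Integrable f μ) :
    Tendsto (fun i => ∫ x, max (f x - c i) 0 ∂μ) l (𝓝 0) := by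
  suffices Tendsto (fun i => ∫ x, max (f x - c i) 0 ∂μ) l (𝓝 (∫ _, (0 : ℝ) ∂μ)) by
    simpa using this
  refine tendsto_integral_filter_of_dominated_convergence (fun x => ‖f x‖) ?_ ?_ hf.norm ?_
  · exact .of_forall fun i =>
      (hf.aestronglyMeasurable.sub aestronglyMeasurable_const).sup aestronglyMeasurable_const
  · filter_upwards [hc.eventually_ge_atTop 0] with i hi
    refine ae_of_all _ fun x => ?_
    rw [Real.norm_of_nonneg (le_max_right _ _), Real.norm_eq_abs]
    exact max_le (by linarith [le_abs_self (f x)]) (abs_nonneg _)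
  · refine ae_of_all _ fun x => tendsto_const_nhds.congr' ?_
    filter_upwards [hc.eventually_ge_atTop (f x)] with i hi
    exact (max_eq_right (by linarith)).symm

theorem setIntegral_sq_div_one_add_sq_le {s t L : ℝ} (hL : 0 < L) {f : ℝ → ℝ}
    (hf : Measurable f) {B : Set ℝ} (hB : MeasurableSet B)
    (hBsub : ∀ τ ∈ B, τ ∈ Ioo s t ∧ L ≤ f τ) :
    ∫ τ in B, f τ ^ 2 / (1 + f τ ^ 2) ≤ ∫ τ in Ioo s t, rampCutoff L (f τ) := by
  have hsub : B ⊆ Ioo s t := fun τ hτ => (hBsub τ hτ).1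
  have hint : IntegrableOn (fun τ => rampCutoff L (f τ)) (Ioo s t) :=
    integrable_rampCutoff_comp hL hf
  calc ∫ τ in B, f τ ^ 2 / (1 + f τ ^ 2) ≤ ∫ τ in B, rampCutoff L (f τ) := by
        refine integral_mono_of_nonneg (ae_of_all _ fun τ => sq_div_one_add_sq_nonneg _)
          (hint.mono_set hsub) ?_
        filter_upwards [ae_restrict_mem hB] with τ hτ
        rw [rampCutoff_eq_one hL (hBsub τ hτ).2]
        exact sq_div_one_add_sq_le_one _
    _ ≤ ∫ τ in Ioo s t, rampCutoff L (f τ) :=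
        setIntegral_mono_set hint (ae_of_all _ fun τ => rampCutoff_nonneg hL _)
          hsub.eventuallyLE

/-- Let `(s,t)` be a bounded interval, `ρm, ρ : (s,t) → [0,∞)` measurable
with `ρm m (τ) → ρ(τ)` a.e. and `ρ ∈ L¹(s,t)`.  For each `α ∈ (0,1)` and `m`, let
`A α m ⊆ {τ ∈ (s,t) : ρm m (τ) > tan(απ/2)}` be measurable.  Then
`lim_{α→1⁻} limsup_m (1/(1-α)) ∫_{A α m} ρm²/(1+ρm²) dτ = 0`. -/
theorem stmt15 (s t : ℝ) (hst : s < t)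
    (ρm : ℕ → ℝ → ℝ) (ρ : ℝ → ℝ)
    (hρm_meas : ∀ m, Measurable (ρm m)) (hρ_meas : Measurable ρ)
    (hρm_nonneg : ∀ m, ∀ τ ∈ Set.Ioo s t, 0 ≤ ρm m τ)
    (hρ_nonneg : ∀ τ ∈ Set.Ioo s t, 0 ≤ ρ τ)
    (h_tendsto : ∀ᵐ τ ∂(volume.restrict (Set.Ioo s t)),
      Tendsto (fun m => ρm m τ) atTop (𝓝 (ρ τ)))
    (hρ_int : IntegrableOn ρ (Set.Ioo s t))
    (A : ℝ → ℕ → Set ℝ)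
    (hA_meas : ∀ α ∈ Set.Ioo (0:ℝ) 1, ∀ m, MeasurableSet (A α m))
    (hA_sub : ∀ α ∈ Set.Ioo (0:ℝ) 1, ∀ m,
      A α m ⊆ {τ | τ ∈ Set.Ioo s t ∧ Real.tan (α * (Real.pi / 2)) < ρm m τ}) :
    Tendsto (fun α => Filter.limsup
        (fun m => (1 / (1 - α)) * ∫ τ in A α m, ρm m τ ^ 2 / (1 + ρm m τ ^ 2)) atTop)
      (𝓝[<] 1) (𝓝 0) := by
  have hpi := Real.pi_pos
  have hL_tendsto : Tendsto (fun α : ℝ => (π * (1 - α))⁻¹ / 2) (𝓝[<] 1) atTop := by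
    refine Tendsto.atTop_div_const two_pos (tendsto_inv_nhdsGT_zero.comp ?_)
    refine tendsto_nhdsWithin_iff.2 ⟨?_, ?_⟩
    · have : Continuous fun α : ℝ => π * (1 - α) := by fun_prop
      simpa using (this.tendsto 1).mono_left nhdsWithin_le_nhds
    · filter_upwards [self_mem_nhdsWithin] with α hα
      exact mul_pos hpi (sub_pos.2 hα)
  have hbound : Tendsto (fun α : ℝ =>
      2 * π * ∫ τ in Ioo s t, max (ρ τ - (π * (1 - α))⁻¹ / 2) 0) (𝓝[<] 1) (𝓝 0) := by
    simpa using (tendsto_integral_max_sub_zero hL_tendsto hρ_int).const_mul (2 * π)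
  have hnear : ∀ᶠ α : ℝ in 𝓝[<] 1, α ∈ Ioo (1 / 2 : ℝ) 1 := Ioo_mem_nhdsLT (by norm_num)
  have key : ∀ α ∈ Ioo (1 / 2 : ℝ) 1,
      0 ≤ limsup (fun m => (1 / (1 - α)) *
        ∫ τ in A α m, ρm m τ ^ 2 / (1 + ρm m τ ^ 2)) atTop ∧
      limsup (fun m => (1 / (1 - α)) *
        ∫ τ in A α m, ρm m τ ^ 2 / (1 + ρm m τ ^ 2)) atTop ≤
        2 * π * ∫ τ in Ioo s t, max (ρ τ - (π * (1 - α))⁻¹ / 2) 0 := by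
    intro α hα
    have hα01 : α ∈ Ioo (0 : ℝ) 1 := ⟨by linarith [hα.1], hα.2⟩
    have hα1 : 0 < 1 - α := sub_pos.2 hα.2
    set L := (π * (1 - α))⁻¹ with hLdef
    have hL : 0 < L := by positivity
    have hLπ : 1 / (1 - α) = π * L := by rw [hLdef]; field_simp
    set u := fun m => (1 / (1 - α)) * ∫ τ in A α m, ρm m τ ^ 2 / (1 + ρm m τ ^ 2) with hu
    set v := fun m => (1 / (1 - α)) * ∫ τ in Ioo s t, rampCutoff L (ρm m τ) with hv
    have hu0 : ∀ m, 0 ≤ u m := fun m =>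
      mul_nonneg (by positivity) (integral_nonneg fun τ => sq_div_one_add_sq_nonneg _)
    have huv : ∀ m, u m ≤ v m := fun m => by
      refine mul_le_mul_of_nonneg_left (setIntegral_sq_div_one_add_sq_le hL (hρm_meas m)
        (hA_meas α hα01 m) fun τ hτ => ?_) (by positivity)
      obtain ⟨hmem, htan⟩ := hA_sub α hα01 m hτ
      exact ⟨hmem, (inv_pi_mul_one_sub_le_tan hα.1.le hα.2).trans htan.le⟩
    have hv_tendsto : Tendsto v atTop
        (𝓝 ((1 / (1 - α)) * ∫ τ in Ioo s t, rampCutoff L (ρ τ))) := by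
      refine Tendsto.const_mul _ (tendsto_integral_of_dominated_convergence (fun _ => 1)
        (fun m => (integrable_rampCutoff_comp hL (hρm_meas m)).aestronglyMeasurable)
        (integrable_const _) (fun m => ae_of_all _ fun τ => norm_rampCutoff_le_one hL _) ?_)
      filter_upwards [h_tendsto] with τ hτ
      exact ((continuous_rampCutoff L).tendsto _).comp hτ
    have hub : IsBoundedUnder (· ≤ ·) atTop u :=
      hv_tendsto.isBoundedUnder_le.mono_le (.of_forall huv)
    have hub' : IsBoundedUnder (· ≥ ·) atTop u := isBoundedUnder_of ⟨0, hu0⟩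
    refine ⟨le_limsup_of_frequently_le (.of_forall hu0) hub, ?_⟩
    calc limsup u atTop ≤ limsup v atTop :=
          limsup_le_limsup (.of_forall huv) hub'.isCoboundedUnder_le
            hv_tendsto.isBoundedUnder_le
      _ = π * L * ∫ τ in Ioo s t, rampCutoff L (ρ τ) := by rw [hv_tendsto.limsup_eq, hLπ]
      _ ≤ π * L * ∫ τ in Ioo s t, 2 / L * max (ρ τ - L / 2) 0 := by
          refine mul_le_mul_of_nonneg_left (integral_mono
            (integrable_rampCutoff_comp hL hρ_meas) ?_ fun τ => min_le_right _ _) (by positivity)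
          exact ((hρ_int.sub (integrable_const _)).pos_part).const_mul _
      _ = 2 * π * ∫ τ in Ioo s t, max (ρ τ - L / 2) 0 := by
          rw [integral_const_mul]
          field_simp
  refine tendsto_of_tendsto_of_tendsto_of_le_of_le' tendsto_const_nhds hbound ?_ ?_
  · filter_upwards [hnear] with α hα using (key α hα).1
  · filter_upwards [hnear] with α hα using (key α hα).2
end
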